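/- The color assignment for ultra-parallel lines is injective on positive reals: for all real r > 0, the complex number i·T(r), where T(z) = (i·z + 1)/(z + i), has argument strictly between 0 and π; and for all real r, s > 0, if 2·arg(i·T(r)) = 2·arg(i·T(s)) then r = s. -/

import Mathlib

open Complex

theorem Real.cos_two_mul_arctan (r : ℝ) :
    Real.cos (2 * Real.arctan r) = (1 - r ^ 2) / (1 + r ^ 2) := by
  have h : 1 + r ^ 2 ≠ 0 := by positivity
  rw [Real.cos_two_mul, Real.cos_sq_arctan]
  field_simp
  ring

theorem Real.sin_two_mul_arctan (r : ℝ) :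
    Real.sin (2 * Real.arctan r) = 2 * r / (1 + r ^ 2) := by
  have h : Real.sin (Real.arctan r) = r * Real.cos (Real.arctan r) := by
    rw [Real.sin_arctan, Real.cos_arctan, mul_one_div]
  rw [Real.sin_two_mul, h]
  calc 2 * (r * Real.cos (Real.arctan r)) * Real.cos (Real.arctan r)
      = 2 * r * Real.cos (Real.arctan r) ^ 2 := by ring
    _ = 2 * r / (1 + r ^ 2) := by rw [Real.cos_sq_arctan, mul_one_div]

theorem I_mul_cayley_eq_cos_add_sin_mul_I (r : ℝ) :
    I * ((I * r + 1) / (r + I)) =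
      cos (2 * Real.arctan r : ℝ) + sin (2 * Real.arctan r : ℝ) * I := by
  have hden : (r : ℂ) + I ≠ 0 := fun h => by simpa using congrArg im h
  have hsq : (1 : ℂ) + (r : ℂ) ^ 2 ≠ 0 := by
    exact_mod_cast (by positivity : (1 : ℝ) + r ^ 2 ≠ 0)
  rw [← ofReal_cos, ← ofReal_sin, Real.cos_two_mul_arctan, Real.sin_two_mul_arctan]
  push_cast
  field_simp
  linear_combination (r ^ 3 - r : ℂ) * I_sq

theorem arg_I_mul_cayley {r : ℝ} (hr : 0 < r) :
    arg (I * ((I * r + 1) / (r + I))) = 2 * Real.arctan r := by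
  rw [I_mul_cayley_eq_cos_add_sin_mul_I]
  apply arg_cos_add_sin_mul_I
  have hpos := Real.arctan_pos.mpr hr
  have hlt := Real.arctan_lt_pi_div_two r
  constructor <;> linarith [Real.pi_pos]

/-- The color assignment for ultra-parallel lines: for `r > 0`, `i·T(r)` has argument
strictly between `0` and `π`, and `r ↦ 2·arg(i·T r)` is injective on positive reals,
where `T(z) = (i z + 1)/(z + i)`. -/
theorem ultraparallel_coloring_injective
    (T : ℂ → ℂ) (hT : ∀ z : ℂ, T z = (I * z + 1) / (z + I)) :
    (∀ r : ℝ, 0 < r →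
        0 < Complex.arg (I * T r) ∧ Complex.arg (I * T r) < Real.pi) ∧
      (∀ r s : ℝ, 0 < r → 0 < s →
        2 * Complex.arg (I * T r) = 2 * Complex.arg (I * T s) → r = s) := by
  constructor
  · intro r hr
    rw [hT, arg_I_mul_cayley hr]
    have hpos := Real.arctan_pos.mpr hr
    have hlt := Real.arctan_lt_pi_div_two r
    constructor <;> linarith
  · intro r s hr hs h
    rw [hT, hT, arg_I_mul_cayley hr, arg_I_mul_cayley hs] at h
    exact Real.arctan_injective (by linarith)
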